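/- arXiv:1812.08763 — 3 statements merged into one kernel-verified Lean document; each statement's English description precedes it below -/
import Mathlib

section
/- Let U be a splitting set of an objective program Π. A propositional interpretation I ⊆ At is a stable model of Π if and only if ⟨I ∩ U, I \ U⟩ is a solution of Π with respect to U. -/
open scoped Classical

variable {At : Type}

/-! ### Objective literals, rules and programs -/

/-- Objective literals: truth constants, an atom `a`, `not a`, or `not not a`. -/
inductive OLit (At : Type) : Type
  | top : OLit At
  | bot : OLit At
  | pos (a : At) : OLit At
  | neg (a : At) : OLit At
  | nneg (a : At) : OLit At

namespace OLit

/-- Classical satisfaction of an objective literal by an interpretation `I`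
(`not` is read as classical negation). -/
def sat (I : Set At) : OLit At → Prop
  | .top => True
  | .bot => False
  | .pos a => a ∈ I
  | .neg a => a ∉ I
  | .nneg a => a ∈ I

/-- Atoms occurring in an objective literal. -/
def atoms : OLit At → Set At
  | .top => ∅
  | .bot => ∅
  | .pos a => {a}
  | .neg a => {a}
  | .nneg a => {a}

/-- The reduct of a literal w.r.t. `I`: every negated part is replaced by its
truth value w.r.t. `I`. -/
noncomputable def reduct (I : Set At) : OLit At → OLit At
  | .top => .top
  | .bot => .bot
  | .pos a => .pos a
  | .neg a => if a ∈ I then .bot else .top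
  | .nneg a => if a ∈ I then .top else .bot

/-- Replace every atom belonging to `U` by `⊤` if it is in `I` and by `⊥` otherwise. -/
noncomputable def esimp (U I : Set At) : OLit At → OLit At
  | .top => .top
  | .bot => .bot
  | .pos a => if a ∈ U then (if a ∈ I then .top else .bot) else .pos a
  | .neg a => if a ∈ U then (if a ∈ I then .bot else .top) else .neg a
  | .nneg a => if a ∈ U then (if a ∈ I then .top else .bot) else .nneg a

/-- Default negation `not l` of an objective literal. -/
def negate : OLit At → OLit At
  | .top => .bot
  | .bot => .top
  | .pos a => .neg a
  | .neg a => .nneg a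
  | .nneg a => .neg a

end OLit

/-- An objective rule `a₁ ∨ … ∨ aₙ ← L₁, …, Lₘ`. -/
structure ORule (At : Type) : Type where
  head : List At
  body : List (OLit At)

namespace ORule

/-- Classical satisfaction of a rule. -/
def sat (I : Set At) (r : ORule At) : Prop :=
  (∀ L ∈ r.body, L.sat I) → ∃ a ∈ r.head, a ∈ I

/-- The head atoms of a rule, as a set. -/
def headAtoms (r : ORule At) : Set At := {a | a ∈ r.head}

/-- All atoms occurring in a rule. -/
def atoms (r : ORule At) : Set At := r.headAtoms ∪ ⋃ L ∈ r.body, L.atoms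

/-- Reduct of a rule w.r.t. `I`. -/
noncomputable def reduct (I : Set At) (r : ORule At) : ORule At :=
  ⟨r.head, r.body.map (OLit.reduct I)⟩

/-- Replace in the body every atom of `U` by its truth value w.r.t. `I`. -/
noncomputable def esimp (U I : Set At) (r : ORule At) : ORule At :=
  ⟨r.head, r.body.map (OLit.esimp U I)⟩

end ORule

/-- `I` is a classical model of the objective program `P`. -/
def isOModel (I : Set At) (P : Set (ORule At)) : Prop := ∀ r ∈ P, r.sat I

/-- The reduct `P^I` of an objective program. -/
noncomputable def oReduct (P : Set (ORule At)) (I : Set At) : Set (ORule At) :=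
  (ORule.reduct I) '' P

/-- `I` is a stable model of `P`: a ⊆-minimal classical model of `P^I`. -/
def isStable (I : Set At) (P : Set (ORule At)) : Prop :=
  isOModel I (oReduct P I) ∧ ∀ J : Set At, J ⊆ I → isOModel J (oReduct P I) → J = I

/-- `SM[P]`, the set of stable models of `P`. -/
def SMs (P : Set (ORule At)) : Set (Set At) := {I | isStable I P}

/-- `U` is a splitting set of the objective program `P`. -/
def isSplittingSet (U : Set At) (P : Set (ORule At)) : Prop :=
  ∀ r ∈ P, r.atoms ⊆ U ∨ r.headAtoms ∩ U = ∅

/-- The bottom `b_U(P)`. -/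
def oBottom (U : Set At) (P : Set (ORule At)) : Set (ORule At) := {r ∈ P | r.atoms ⊆ U}

/-- The top `t_U(P)`. -/
def oTop (U : Set At) (P : Set (ORule At)) : Set (ORule At) := P \ oBottom U P

/-- Simplify a (top) program by replacing every atom of `U` by its truth value w.r.t. `I`. -/
noncomputable def simpProg (U I : Set At) (T : Set (ORule At)) : Set (ORule At) :=
  (ORule.esimp U I) '' T

/-- `e_U(P, I)`. -/
noncomputable def eU (U : Set At) (P : Set (ORule At)) (I : Set At) : Set (ORule At) :=
  simpProg U I (oTop U P)

/-- `⟨Ib, It⟩` is a solution of `P` w.r.t. `U`. -/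
def isSolution (U : Set At) (P : Set (ORule At)) (Ib It : Set At) : Prop :=
  isStable Ib (oBottom U P) ∧ isStable It (eU U P Ib)

/-- `⟨B, T⟩` is an arbitrary splitting of `P` w.r.t. the splitting set `U`. -/
def isArbSplitting (U : Set At) (P B T : Set (ORule At)) : Prop :=
  B ∩ T = ∅ ∧ B ∪ T = P ∧ (∀ r ∈ B, r.atoms ⊆ U) ∧ (∀ r ∈ T, r.headAtoms ∩ U = ∅)

/-! ### Epistemic specifications -/

/-- Subjective literals `K l`, `M l`, `not K l`, `not M l`. -/
inductive SLit (At : Type) : Type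
  | k (l : OLit At) : SLit At
  | m (l : OLit At) : SLit At
  | notk (l : OLit At) : SLit At
  | notm (l : OLit At) : SLit At

namespace SLit

/-- Satisfaction `W ⊨ L` of a subjective literal by a set of interpretations. -/
def sat (W : Set (Set At)) : SLit At → Prop
  | .k l => ∀ I ∈ W, l.sat I
  | .m l => ∃ I ∈ W, l.sat I
  | .notk l => ¬ ∀ I ∈ W, l.sat I
  | .notm l => ¬ ∃ I ∈ W, l.sat I

/-- Atoms occurring in a subjective literal. -/
def atoms : SLit At → Set At
  | .k l => l.atoms
  | .m l => l.atoms
  | .notk l => l.atoms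
  | .notm l => l.atoms

end SLit

/-- A body literal of an epistemic rule: objective or subjective. -/
inductive ELit (At : Type) : Type
  | obj (l : OLit At) : ELit At
  | sub (L : SLit At) : ELit At

namespace ELit

/-- Atoms occurring in a body literal. -/
def atoms : ELit At → Set At
  | .obj l => l.atoms
  | .sub L => L.atoms

/-- Atoms occurring in a body literal, if it is objective. -/
def objAtoms : ELit At → Set At
  | .obj l => l.atoms
  | .sub _ => ∅

/-- Atoms occurring in a body literal, if it is subjective. -/
def subAtoms : ELit At → Set At
  | .obj _ => ∅
  | .sub L => L.atoms

/-- The body literal is objective. -/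
def isObj : ELit At → Prop
  | .obj _ => True
  | .sub _ => False

/-- Subjective reduct of a body literal w.r.t. `W` and signature `U`. -/
noncomputable def sReduct (W : Set (Set At)) (U : Set At) : ELit At → ELit At
  | .obj l => .obj l
  | .sub L => if L.atoms ⊆ U then (if L.sat W then .obj .top else .obj .bot) else .sub L

/-- Subjective reduct of a body literal w.r.t. `W` for the full signature:
every subjective literal is replaced by its truth value, so the result is objective. -/
noncomputable def fullReduct (W : Set (Set At)) : ELit At → OLit At
  | .obj l => l
  | .sub L => if L.sat W then .top else .bot

end ELit

/-- An epistemic rule `a₁ ∨ … ∨ aₙ ← L₁, …, Lₘ`. -/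
structure ERule (At : Type) : Type where
  head : List At
  body : List (ELit At)

namespace ERule

/-- Head atoms of an epistemic rule. -/
def headAtoms (r : ERule At) : Set At := {a | a ∈ r.head}

/-- All atoms of an epistemic rule. -/
def atoms (r : ERule At) : Set At := r.headAtoms ∪ ⋃ L ∈ r.body, L.atoms

/-- Atoms occurring in objective body literals (`Atoms(Body_obj(r))`). -/
def bodyObjAtoms (r : ERule At) : Set At := ⋃ L ∈ r.body, L.objAtoms

/-- Atoms occurring in subjective body literals (`Atoms(Body_sub(r))`). -/
def bodySubAtoms (r : ERule At) : Set At := ⋃ L ∈ r.body, L.subAtoms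

/-- The rule is objective: no subjective literal occurs in it. -/
def isObjective (r : ERule At) : Prop := ∀ L ∈ r.body, L.isObj

/-- The rule is a subjective constraint: empty head and only subjective body literals. -/
def isSubjConstraint (r : ERule At) : Prop := r.head = [] ∧ ∀ L ∈ r.body, ¬ L.isObj

/-- Subjective reduct `r^W_U` of an epistemic rule. -/
noncomputable def sReduct (W : Set (Set At)) (U : Set At) (r : ERule At) : ERule At :=
  ⟨r.head, r.body.map (ELit.sReduct W U)⟩

/-- Subjective reduct `r^W` for the full signature, as an objective rule. -/
noncomputable def fullReduct (W : Set (Set At)) (r : ERule At) : ORule At :=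
  ⟨r.head, r.body.map (ELit.fullReduct W)⟩

end ERule

/-- Subjective reduct `P^W_U` of an epistemic program. -/
noncomputable def esReduct (P : Set (ERule At)) (W : Set (Set At)) (U : Set At) :
    Set (ERule At) :=
  (ERule.sReduct W U) '' P

/-- Subjective reduct `P^W` (full signature), as an objective program. -/
noncomputable def eFullReduct (P : Set (ERule At)) (W : Set (Set At)) : Set (ORule At) :=
  (ERule.fullReduct W) '' P

/-- Projection `W|_V` of a set of interpretations to the atoms in `V`. -/
def proj (W : Set (Set At)) (V : Set At) : Set (Set At) := (fun I => I ∩ V) '' W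

/-- `U` is an epistemic splitting set of `P`. -/
def isEpiSplittingSet (U : Set At) (P : Set (ERule At)) : Prop :=
  ∀ r ∈ P, r.atoms ⊆ U ∨ (r.bodyObjAtoms ∪ r.headAtoms) ∩ U = ∅

/-- `⟨B, T⟩` is a splitting of `P` w.r.t. the epistemic splitting set `U`. -/
def isEpiSplitting (U : Set At) (P B T : Set (ERule At)) : Prop :=
  B ∩ T = ∅ ∧ B ∪ T = P ∧ (∀ r ∈ B, r.atoms ⊆ U) ∧
    (∀ r ∈ T, (r.bodyObjAtoms ∪ r.headAtoms) ∩ U = ∅)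

/-- `W_b ⊔ W_t = { Ib ∪ It : Ib ∈ W_b, It ∈ W_t }`. -/
def squnion (Wb Wt : Set (Set At)) : Set (Set At) :=
  {I | ∃ Ib ∈ Wb, ∃ It ∈ Wt, I = Ib ∪ It}

/-- G91-world view: a nonempty `W` with `W = SM[P^W]`. -/
def isG91WorldView (W : Set (Set At)) (P : Set (ERule At)) : Prop :=
  W.Nonempty ∧ W = SMs (eFullReduct P W)

/-! ### Abstract semantics and its properties -/

/-- A semantics assigns to every epistemic program a collection of world views. -/
abbrev Semantics (At : Type) : Type := Set (ERule At) → Set (Set (Set At))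

/-- The objective program corresponding to an epistemic program without
subjective literals (the subjective reduct is independent of the world view there). -/
noncomputable def toObjProg (P : Set (ERule At)) : Set (ORule At) := eFullReduct P ∅

/-- Supra-ASP: on objective programs, either the unique world view is the nonempty
set of stable models, or there are no stable models and no world view. -/
def SupraASP (S : Semantics At) : Prop :=
  ∀ P : Set (ERule At), (∀ r ∈ P, r.isObjective) →
    ((SMs (toObjProg P) ≠ ∅ ∧ S P = {SMs (toObjProg P)}) ∨
     (SMs (toObjProg P) = ∅ ∧ S P = ∅))

/-- The epistemic splitting property for a semantics `S`. -/
def EpistemicSplittingProp (S : Semantics At) : Prop :=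
  ∀ (U : Set At) (P B T : Set (ERule At)), isEpiSplitting U P B T →
    ∀ W : Set (Set At),
      W ∈ S P ↔ ∃ Wb ∈ S B, ∃ Wt ∈ S (esReduct T Wb U), W = squnion Wb Wt

/-- Modal dependence relation `dep(a, b)`. -/
def dep (P : Set (ERule At)) (a b : At) : Prop :=
  ∃ r ∈ P, a ∈ r.headAtoms ∪ r.bodyObjAtoms ∧ b ∈ r.bodySubAtoms

/-- `P` is epistemically stratified. -/
def EpistemicallyStratified (P : Set (ERule At)) : Prop :=
  ∃ lam : At → ℕ,
    (∀ r ∈ P, ∀ a ∈ r.atoms \ r.bodySubAtoms, ∀ b ∈ r.atoms \ r.bodySubAtoms,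
        lam a = lam b) ∧
    (∀ a b : At, dep P a b → lam b < lam a)

/-- `W ⊨ r` for a subjective constraint `r`: some subjective body literal fails in `W`. -/
def wvSatConstraint (W : Set (Set At)) (r : ERule At) : Prop :=
  ∃ L ∈ r.body, ∃ s : SLit At, L = ELit.sub s ∧ ¬ s.sat W

/-- Subjective constraint monotonicity for a semantics `S`. -/
def SubjConstraintMonotonicity (S : Semantics At) : Prop :=
  ∀ (P : Set (ERule At)) (r : ERule At), r.isSubjConstraint →
    ∀ W : Set (Set At), W.Nonempty →
      (W ∈ S (P ∪ {r}) ↔ W ∈ S P ∧ wvSatConstraint W r)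

/-! ### The G11 semantics -/

/-- G11-reduct of a body literal: `K l` is replaced by `l` when `W ⊨ K l` and by `⊥`
otherwise; the remaining subjective literals are replaced by their truth value. -/
noncomputable def ELit.g11Reduct (W : Set (Set At)) : ELit At → OLit At
  | .obj l => l
  | .sub (.k l) => if (SLit.k l).sat W then l else OLit.bot
  | .sub (.notk l) => if (SLit.notk l).sat W then OLit.top else OLit.bot
  | .sub (.m l) => if (SLit.m l).sat W then OLit.top else OLit.bot
  | .sub (.notm l) => if (SLit.notm l).sat W then OLit.top else OLit.bot

/-- G11-reduct of a program. -/
noncomputable def g11Reduct (P : Set (ERule At)) (W : Set (Set At)) : Set (ORule At) :=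
  (fun r : ERule At => (⟨r.head, r.body.map (ELit.g11Reduct W)⟩ : ORule At)) '' P

/-- G11-world view. -/
def isG11WorldView (W : Set (Set At)) (P : Set (ERule At)) : Prop :=
  W.Nonempty ∧ W = SMs (g11Reduct P W)

/-! ### The K15 and S17 semantics -/

/-- K15-reduct of a body literal: occurrences of `K l` with `W ⊭ K l` become `⊥`,
all other occurrences of `K l` are replaced by `l` (so `not K l` becomes `not l`
when `W ⊨ K l` and `⊤` otherwise; `M l` is treated as `not K not l`). -/
noncomputable def ELit.k15Reduct (W : Set (Set At)) : ELit At → OLit At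
  | .obj l => l
  | .sub (.k l) => if (SLit.k l).sat W then l else OLit.bot
  | .sub (.notk l) => if (SLit.k l).sat W then l.negate else OLit.top
  | .sub (.m l) => if (SLit.k l.negate).sat W then l.negate.negate else OLit.top
  | .sub (.notm l) => if (SLit.k l.negate).sat W then l.negate else OLit.bot

/-- K15-reduct of a program. -/
noncomputable def k15Reduct (P : Set (ERule At)) (W : Set (Set At)) : Set (ORule At) :=
  (fun r : ERule At => (⟨r.head, r.body.map (ELit.k15Reduct W)⟩ : ORule At)) '' P

/-- K15-world view. -/
def isK15WorldView (W : Set (Set At)) (P : Set (ERule At)) : Prop :=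
  W.Nonempty ∧ W = SMs (k15Reduct P W)

/-- The objective literals `l` such that `K l` occurs in `P`. -/
def kLits (P : Set (ERule At)) : Set (OLit At) :=
  {l | ∃ r ∈ P, ∃ L ∈ r.body, L = ELit.sub (SLit.k l) ∨ L = ELit.sub (SLit.notk l)}

/-- `Φ_W`: the epistemic literals `not K l` of `E_P` satisfied by `W`. -/
def Phi (P : Set (ERule At)) (W : Set (Set At)) : Set (OLit At) :=
  {l ∈ kLits P | (SLit.notk l).sat W}

/-- S17-world view: a K15-world view maximizing the satisfied epistemic negations. -/
def isS17WorldView (W : Set (Set At)) (P : Set (ERule At)) : Prop :=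
  isK15WorldView W P ∧
    ¬ ∃ W' : Set (Set At), isK15WorldView W' P ∧ Phi P W ⊂ Phi P W'

/-! ### EHT and the F15 semantics -/

/-- EHT satisfaction of an objective literal at point `I` with "here" mapping `h`. -/
def OLit.ehtSat (h : Set At → Set At) (I : Set At) : OLit At → Prop
  | .top => True
  | .bot => False
  | .pos a => a ∈ h I
  | .neg a => a ∉ I
  | .nneg a => a ∈ I

/-- EHT satisfaction of a subjective literal. -/
def SLit.ehtSat (W : Set (Set At)) (h : Set At → Set At) : SLit At → Prop
  | .k l => ∀ I' ∈ W, l.ehtSat h I'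
  | .m l => ∃ I' ∈ W, l.ehtSat h I'
  | .notk l => ¬ ∀ I' ∈ W, l.ehtSat id I'
  | .notm l => ¬ ∃ I' ∈ W, l.ehtSat id I'

/-- EHT satisfaction of a body literal at point `I`. -/
def ELit.ehtSat (W : Set (Set At)) (h : Set At → Set At) (I : Set At) : ELit At → Prop
  | .obj l => l.ehtSat h I
  | .sub L => L.ehtSat W h

/-- EHT satisfaction of a rule at point `I`. -/
def ERule.ehtSat (W : Set (Set At)) (h : Set At → Set At) (I : Set At) (r : ERule At) : Prop :=
  (∀ L ∈ r.body, L.ehtSat W h I) → ∃ a ∈ r.head, a ∈ h I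

/-- `⟨W, h⟩` is an EHT-model of `P` (with `W` nonempty and `h T ⊆ T` on `W`). -/
def isEHTModel (W : Set (Set At)) (h : Set At → Set At) (P : Set (ERule At)) : Prop :=
  W.Nonempty ∧ (∀ T ∈ W, h T ⊆ T) ∧ ∀ I ∈ W, ∀ r ∈ P, r.ehtSat W h I

/-- `W` is an equilibrium EHT-model of `P`. -/
def isEquilibriumEHT (W : Set (Set At)) (P : Set (ERule At)) : Prop :=
  isEHTModel W id P ∧
    ¬ ∃ h : Set At → Set At, isEHTModel W h P ∧ ∃ I ∈ W, h I ⊂ I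

/-- The auxiliary relation `W, X ⊨* P`. -/
def satStar (W X : Set (Set At)) (P : Set (ERule At)) : Prop :=
  (∀ I ∈ X, ∀ r ∈ P, r.ehtSat W id I) ∧
  (∀ h : Set At → Set At, (∀ T ∈ W, h T ⊆ T) → (∀ T ∈ W \ X, h T = T) →
    (∃ I ∈ W, ∀ r ∈ P, r.ehtSat W h I) → ∀ T ∈ W, h T = T)

/-- The preference order `W ≤_P W'`. -/
def prefLE (P : Set (ERule At)) (W W' : Set (Set At)) : Prop :=
  ∀ I : Set At, (∃ V : Set (Set At), isEquilibriumEHT V P ∧ I ∈ V) →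
    (satStar (W ∪ {I}) W P → satStar (W' ∪ {I}) W' P)

/-- F15-world view: an equilibrium EHT-model maximal w.r.t. `⊂` and `<_P`. -/
def isF15WorldView (W : Set (Set At)) (P : Set (ERule At)) : Prop :=
  isEquilibriumEHT W P ∧
    ¬ ∃ W' : Set (Set At), isEquilibriumEHT W' P ∧
        (W ⊂ W' ∨ (prefLE P W W' ∧ ¬ prefLE P W' W))

/-- Models of the reduct of a program, rule by rule. -/
theorem isOModel_oReduct_iff {P : Set (ORule At)} {I J : Set At} :
    isOModel J (oReduct P I) ↔ ∀ r ∈ P, (r.reduct I).sat J := by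
  simp [isOModel, oReduct]

theorem isOModel_oReduct_eU_iff {P : Set (ORule At)} {U K I J : Set At} :
    isOModel J (oReduct (eU U P K) I) ↔ ∀ r ∈ oTop U P, ((r.esimp U K).reduct I).sat J := by
  simp [isOModel, oReduct, eU, simpProg]

theorem OLit.sat_reduct_mono {L : OLit At} {I J K : Set At} (hJK : J ⊆ K)
    (h : (L.reduct I).sat J) : (L.reduct I).sat K := by
  cases L <;> simp only [OLit.reduct] at h ⊢ <;> (try split_ifs at h ⊢) <;>
    simp_all [OLit.sat]
  exact hJK h

theorem OLit.sat_reduct_inter_iff {L : OLit At} {U I J : Set At} (hL : L.atoms ⊆ U) :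
    (L.reduct (I ∩ U)).sat (J ∩ U) ↔ (L.reduct I).sat J := by
  cases L with
  | top => rfl
  | bot => rfl
  | _ a =>
    have hU : a ∈ U := hL rfl
    by_cases hI : a ∈ I <;> simp [OLit.reduct, OLit.sat, hU, hI]

theorem OLit.sat_reduct_esimp_iff {L : OLit At} {U I J : Set At} (hJ : J ∩ U = I ∩ U) :
    ((L.esimp U (I ∩ U)).reduct (I \ U)).sat (J \ U) ↔ (L.reduct I).sat J := by
  have key (a : At) (ha : a ∈ U) : a ∈ J ↔ a ∈ I := by
    simpa [ha] using Set.ext_iff.mp hJ a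
  cases L with
  | top => rfl
  | bot => rfl
  | _ a =>
    by_cases hU : a ∈ U <;> by_cases hI : a ∈ I <;>
      simp [OLit.esimp, OLit.reduct, OLit.sat, hU, hI, key]

theorem ORule.sat_reduct_inter_iff {r : ORule At} {U I J : Set At} (hr : r.atoms ⊆ U) :
    (r.reduct (I ∩ U)).sat (J ∩ U) ↔ (r.reduct I).sat J := by
  have hhead (a : At) (ha : a ∈ r.head) : a ∈ U := hr (Or.inl ha)
  have hbody (L : OLit At) (hL : L ∈ r.body) : L.atoms ⊆ U := fun a ha =>
    hr (Or.inr (Set.mem_biUnion hL ha))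
  simp only [ORule.sat, ORule.reduct, List.forall_mem_map]
  refine imp_congr (forall₂_congr fun L hL => OLit.sat_reduct_inter_iff (hbody L hL)) ?_
  exact exists_congr fun a => and_congr_right fun ha => and_iff_left (hhead a ha)

theorem ORule.sat_reduct_esimp_iff {r : ORule At} {U I J : Set At}
    (hr : r.headAtoms ∩ U = ∅) (hJ : J ∩ U = I ∩ U) :
    ((r.esimp U (I ∩ U)).reduct (I \ U)).sat (J \ U) ↔ (r.reduct I).sat J := by
  have hhead (a : At) (ha : a ∈ r.head) : a ∉ U := fun hU =>
    Set.eq_empty_iff_forall_notMem.mp hr a ⟨ha, hU⟩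
  simp only [ORule.sat, ORule.reduct, ORule.esimp, List.forall_mem_map]
  refine imp_congr (forall₂_congr fun L _ => OLit.sat_reduct_esimp_iff hJ) ?_
  exact exists_congr fun a => and_congr_right fun ha => and_iff_left (hhead a ha)

/-- Shrinking an interpretation without losing head atoms preserves satisfaction of a reduct
rule. -/
theorem ORule.sat_reduct_of_subset {r : ORule At} {I J K : Set At} (hJK : J ⊆ K)
    (hhead : r.headAtoms ∩ K ⊆ J) (h : (r.reduct I).sat K) : (r.reduct I).sat J := by
  simp only [ORule.sat, ORule.reduct, List.forall_mem_map] at h ⊢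
  intro hb
  obtain ⟨a, ha, haK⟩ := h fun L hL => OLit.sat_reduct_mono hJK (hb L hL)
  exact ⟨a, ha, hhead ⟨ha, haK⟩⟩

theorem isSplittingSet.headAtoms_inter_eq_empty {U : Set At} {P : Set (ORule At)}
    (hU : isSplittingSet U P) {r : ORule At} (hr : r ∈ oTop U P) : r.headAtoms ∩ U = ∅ :=
  (hU r hr.1).resolve_left fun h => hr.2 ⟨hr.1, h⟩

theorem isOModel_oReduct_oBottom_iff {U I J : Set At} {P : Set (ORule At)} :
    isOModel (J ∩ U) (oReduct (oBottom U P) (I ∩ U)) ↔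
      ∀ r ∈ oBottom U P, (r.reduct I).sat J :=
  isOModel_oReduct_iff.trans
    (forall₂_congr fun _ hr => ORule.sat_reduct_inter_iff hr.2)

theorem isOModel_oReduct_eU_diff_iff {U I J : Set At} {P : Set (ORule At)}
    (hU : isSplittingSet U P) (hJ : J ∩ U = I ∩ U) :
    isOModel (J \ U) (oReduct (eU U P (I ∩ U)) (I \ U)) ↔
      ∀ r ∈ oTop U P, (r.reduct I).sat J :=
  isOModel_oReduct_eU_iff.trans
    (forall₂_congr fun _ hr => ORule.sat_reduct_esimp_iff (hU.headAtoms_inter_eq_empty hr) hJ)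

theorem isOModel_oReduct_iff_oBottom_oTop {U I J : Set At} {P : Set (ORule At)} :
    isOModel J (oReduct P I) ↔
      (∀ r ∈ oBottom U P, (r.reduct I).sat J) ∧ ∀ r ∈ oTop U P, (r.reduct I).sat J := by
  rw [isOModel_oReduct_iff]
  refine ⟨fun h => ⟨fun r hr => h r hr.1, fun r hr => h r hr.1⟩, fun h r hr => ?_⟩
  by_cases hb : r ∈ oBottom U P
  · exact h.1 r hb
  · exact h.2 r ⟨hr, hb⟩

/-- `I` is a stable model of `P` iff `⟨I ∩ U, I \ U⟩` is a solution of
`P` w.r.t. the splitting set `U`. -/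
theorem splitting_theorem_rewritten (U : Set At) (P : Set (ORule At))
    (hU : isSplittingSet U P) (I : Set At) :
    isStable I P ↔ isSolution U P (I ∩ U) (I \ U) := by
  constructor
  · rintro ⟨hI, hmin⟩
    obtain ⟨hb, ht⟩ := isOModel_oReduct_iff_oBottom_oTop (U := U).mp hI
    refine ⟨⟨isOModel_oReduct_oBottom_iff.mpr hb, fun J hJ hJb => ?_⟩,
      (isOModel_oReduct_eU_diff_iff hU rfl).mpr ht, fun J hJ hJt => ?_⟩
    · have hJI : J ∪ I \ U ⊆ I := Set.union_subset (hJ.trans Set.inter_subset_left) Set.sdiff_subset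
      have hJU : (J ∪ I \ U) ∩ U = J := by
        rw [Set.union_inter_distrib_right, Set.sdiff_inter_self, Set.union_empty]
        exact Set.inter_eq_left.mpr (hJ.trans Set.inter_subset_right)
      rw [← hmin _ hJI (isOModel_oReduct_iff_oBottom_oTop (U := U).mpr
        ⟨isOModel_oReduct_oBottom_iff.mp (hJU.symm ▸ hJb), fun r hr => ?_⟩), hJU]
      refine ORule.sat_reduct_of_subset hJI (fun a ha => Or.inr ⟨ha.2, fun haU => ?_⟩) (ht r hr)
      exact Set.eq_empty_iff_forall_notMem.mp (hU.headAtoms_inter_eq_empty hr) a ⟨ha.1, haU⟩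
    · have hJI : I ∩ U ∪ J ⊆ I := Set.union_subset Set.inter_subset_left (hJ.trans Set.sdiff_subset)
      have hdisj : Disjoint J U := Set.disjoint_sdiff_left.mono_left hJ
      have hJU : (I ∩ U ∪ J) ∩ U = I ∩ U := by
        rw [Set.union_inter_distrib_right, hdisj.inter_eq, Set.union_empty, Set.inter_assoc,
          Set.inter_self]
      have hJd : (I ∩ U ∪ J) \ U = J := by
        rw [Set.union_sdiff_distrib, hdisj.sdiff_eq_left,
          Set.sdiff_eq_empty.mpr Set.inter_subset_right, Set.empty_union]
      rw [← hmin _ hJI (isOModel_oReduct_iff_oBottom_oTop (U := U).mpr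
        ⟨isOModel_oReduct_oBottom_iff.mp ?_,
          (isOModel_oReduct_eU_diff_iff hU hJU).mp (hJd.symm ▸ hJt)⟩), hJd]
      rw [hJU]
      exact isOModel_oReduct_oBottom_iff.mpr hb
  · rintro ⟨⟨hb, hbmin⟩, ht, htmin⟩
    refine ⟨isOModel_oReduct_iff_oBottom_oTop.mpr ⟨isOModel_oReduct_oBottom_iff.mp hb,
      (isOModel_oReduct_eU_diff_iff hU rfl).mp ht⟩, fun J hJ hJm => ?_⟩
    obtain ⟨hJb, hJt⟩ := isOModel_oReduct_iff_oBottom_oTop (U := U).mp hJm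
    have hJU : J ∩ U = I ∩ U := hbmin _ (Set.inter_subset_inter_left U hJ)
      (isOModel_oReduct_oBottom_iff.mpr hJb)
    have hJd : J \ U = I \ U := htmin _ (Set.sdiff_subset_sdiff_left hJ)
      ((isOModel_oReduct_eU_diff_iff hU hJU).mpr hJt)
    rw [← Set.inter_union_sdiff J U, hJU, hJd, Set.inter_union_sdiff]
end

section
/- Let Π be an epistemic program with epistemic splitting set U ⊆ At, let W be a set of propositional interpretations, W_b = W|_U and W_t = W|_{At\U}. Then T_U(Π)^W = E_U(Π, W_b)^{W_t}, where E_U(Π, W_b) = T_U(Π)^{W_b}_U. -/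
open scoped Classical

variable {At : Type}

theorem OLit.sat_inter {l : OLit At} {V : Set At} (h : l.atoms ⊆ V) (I : Set At) :
    l.sat (I ∩ V) ↔ l.sat I := by
  cases l <;> simp_all [OLit.sat, OLit.atoms]

theorem OLit.atoms_subset_or_subset_compl (l : OLit At) (U : Set At) :
    l.atoms ⊆ U ∨ l.atoms ⊆ Uᶜ := by
  cases l <;> simp [OLit.atoms, em]

theorem SLit.atoms_subset_or_subset_compl (L : SLit At) (U : Set At) :
    L.atoms ⊆ U ∨ L.atoms ⊆ Uᶜ := by
  cases L <;> exact OLit.atoms_subset_or_subset_compl _ U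

theorem SLit.sat_proj {L : SLit At} {V : Set At} (h : L.atoms ⊆ V) (W : Set (Set At)) :
    L.sat (proj W V) ↔ L.sat W := by
  cases L <;> simp only [SLit.atoms] at h <;> simp [SLit.sat, proj, OLit.sat_inter h]

theorem ELit.fullReduct_sReduct_proj (W : Set (Set At)) (U : Set At) (L : ELit At) :
    ELit.fullReduct (proj W Uᶜ) (ELit.sReduct (proj W U) U L) = ELit.fullReduct W L := by
  cases L with
  | obj l => rfl
  | sub L =>
    by_cases hU : L.atoms ⊆ U
    · by_cases hW : L.sat W <;>
        simp [ELit.sReduct, ELit.fullReduct, hU, SLit.sat_proj hU, hW]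
    · have hc := (L.atoms_subset_or_subset_compl U).resolve_left hU
      simp [ELit.sReduct, ELit.fullReduct, hU, SLit.sat_proj hc]

theorem ERule.fullReduct_sReduct_proj (W : Set (Set At)) (U : Set At) (r : ERule At) :
    ERule.fullReduct (proj W Uᶜ) (ERule.sReduct (proj W U) U r) = ERule.fullReduct W r := by
  simp [ERule.fullReduct, ERule.sReduct, ELit.fullReduct_sReduct_proj]

/-- `T_U(Π)^W = E_U(Π, W_b)^{W_t}` with `W_b = W|_U`, `W_t = W|_{At∖U}`
and `E_U(Π, W_b) = T_U(Π)^{W_b}_U`. -/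
theorem top_reduct_projection (U : Set At) (P B T : Set (ERule At))
    (h : isEpiSplitting U P B T) (W : Set (Set At)) :
    eFullReduct T W = eFullReduct (esReduct T (proj W U) U) (proj W Uᶜ) := by
  simp only [eFullReduct, esReduct, Set.image_image, ERule.fullReduct_sReduct_proj]
end

section
/- The G91 semantics satisfies the epistemic splitting property: for any epistemic splitting set U of any epistemic program Π, a nonempty set W of propositional interpretations is a G91-world view of Π if and only if there exist W_b and W_t such that W_b is a G91-world view of B_U(Π), W_t is a G91-world view of E_U(Π, W_b), and W = W_b ⊔ W_t := {I_b ∪ I_t : I_b ∈ W_b, I_t ∈ W_t}. -/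
open scoped Classical

variable {At : Type}

/-! ### Stable models of a union of programs over disjoint signatures -/

theorem OLit.sat_reduct_congr {U I I' J J' : Set At} (hI : I ∩ U = I' ∩ U)
    (hJ : J ∩ U = J' ∩ U) {l : OLit At} (hl : l.atoms ⊆ U) :
    (l.reduct I).sat J ↔ (l.reduct I').sat J' := by
  have agree : ∀ {X Y : Set At}, X ∩ U = Y ∩ U → ∀ a ∈ U, (a ∈ X ↔ a ∈ Y) := by
    intro X Y hXY a ha
    simpa [ha] using Set.ext_iff.mp hXY a
  cases l with
  | top => rfl
  | bot => rfl
  | pos a => exact agree hJ a (hl rfl)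
  | neg a => simp only [OLit.reduct, agree hI a (hl rfl)]; split_ifs <;> rfl
  | nneg a => simp only [OLit.reduct, agree hI a (hl rfl)]; split_ifs <;> rfl

theorem ORule.sat_reduct_congr {U I I' J J' : Set At} (hI : I ∩ U = I' ∩ U)
    (hJ : J ∩ U = J' ∩ U) {r : ORule At} (hr : r.atoms ⊆ U) :
    (r.reduct I).sat J ↔ (r.reduct I').sat J' := by
  simp only [ORule.sat, ORule.reduct, List.forall_mem_map]
  refine imp_congr (forall₂_congr fun l hl => ?_)
    (exists_congr fun a => and_congr_right fun ha => ?_)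
  · exact OLit.sat_reduct_congr hI hJ
      ((Set.subset_biUnion_of_mem (u := OLit.atoms) hl).trans (Set.subset_union_right.trans hr))
  · have haU : a ∈ U := hr (Or.inl ha)
    simpa [haU] using Set.ext_iff.mp hJ a

theorem isOModel_oReduct_congr {U I I' J J' : Set At} (hI : I ∩ U = I' ∩ U)
    (hJ : J ∩ U = J' ∩ U) {P : Set (ORule At)} (hP : ∀ r ∈ P, r.atoms ⊆ U) :
    isOModel J (oReduct P I) ↔ isOModel J' (oReduct P I') := by
  simp only [isOModel, oReduct, Set.forall_mem_image]
  exact forall₂_congr fun r hr => ORule.sat_reduct_congr hI hJ (hP r hr)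

theorem isOModel_oReduct_union {I J : Set At} {P Q : Set (ORule At)} :
    isOModel J (oReduct (P ∪ Q) I) ↔ isOModel J (oReduct P I) ∧ isOModel J (oReduct Q I) := by
  simp only [isOModel, oReduct, Set.forall_mem_image, Set.mem_union, or_imp, forall_and]

theorem isStable.subset {U I : Set At} {P : Set (ORule At)} (hP : ∀ r ∈ P, r.atoms ⊆ U)
    (hI : isStable I P) : I ⊆ U := by
  have : I ∩ U = I := hI.2 _ Set.inter_subset_left
    ((isOModel_oReduct_congr rfl (by simp [Set.inter_assoc]) hP).mp hI.1)
  exact Set.inter_eq_left.mp this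

theorem isStable.inter_left {U I : Set At} {P Q : Set (ORule At)}
    (hP : ∀ r ∈ P, r.atoms ⊆ U) (hQ : ∀ r ∈ Q, r.atoms ⊆ Uᶜ)
    (hI : isStable I (P ∪ Q)) : isStable (I ∩ U) P := by
  obtain ⟨hmod, hmin⟩ := hI
  obtain ⟨hmP, hmQ⟩ := isOModel_oReduct_union.mp hmod
  refine ⟨(isOModel_oReduct_congr (by simp [Set.inter_assoc])
      (by simp [Set.inter_assoc]) hP).mp hmP,
    fun J hJ hJm => ?_⟩
  have hJU : J ⊆ U := hJ.trans Set.inter_subset_right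
  have h₁ : (J ∪ I ∩ Uᶜ) ∩ U = J := by
    ext a; have := @hJU a; simp; tauto
  have h₂ : (J ∪ I ∩ Uᶜ) ∩ Uᶜ = I ∩ Uᶜ := by
    ext a; have := @hJU a; simp; tauto
  have key := hmin (J ∪ I ∩ Uᶜ)
    (Set.union_subset (hJ.trans Set.inter_subset_left) Set.inter_subset_left)
    (isOModel_oReduct_union.mpr
      ⟨(isOModel_oReduct_congr (by simp [Set.inter_assoc])
          (by rw [h₁, Set.inter_eq_left.mpr hJU]) hP).mp hJm,
        (isOModel_oReduct_congr rfl h₂.symm hQ).mp hmQ⟩)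
  rw [← h₁, key]

theorem isStable_union_iff {U I : Set At} {P Q : Set (ORule At)}
    (hP : ∀ r ∈ P, r.atoms ⊆ U) (hQ : ∀ r ∈ Q, r.atoms ⊆ Uᶜ) :
    isStable I (P ∪ Q) ↔ isStable (I ∩ U) P ∧ isStable (I ∩ Uᶜ) Q := by
  refine ⟨fun hI => ⟨hI.inter_left hP hQ, ?_⟩, fun ⟨hIP, hIQ⟩ => ⟨?_, fun J hJI hJ => ?_⟩⟩
  · rw [Set.union_comm] at hI
    exact hI.inter_left hQ (by simpa using hP)
  · exact isOModel_oReduct_union.mpr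
      ⟨(isOModel_oReduct_congr (by simp [Set.inter_assoc]) (by simp [Set.inter_assoc]) hP).mp hIP.1,
        (isOModel_oReduct_congr (by simp [Set.inter_assoc])
          (by simp [Set.inter_assoc]) hQ).mp hIQ.1⟩
  · obtain ⟨hJP, hJQ⟩ := isOModel_oReduct_union.mp hJ
    have h₁ : J ∩ U = I ∩ U := hIP.2 _ (Set.inter_subset_inter_left _ hJI)
      ((isOModel_oReduct_congr (by simp [Set.inter_assoc]) (by simp [Set.inter_assoc]) hP).mp hJP)
    have h₂ : J ∩ Uᶜ = I ∩ Uᶜ := hIQ.2 _ (Set.inter_subset_inter_left _ hJI)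
      ((isOModel_oReduct_congr (by simp [Set.inter_assoc]) (by simp [Set.inter_assoc]) hQ).mp hJQ)
    rw [← Set.inter_union_compl J U, h₁, h₂, Set.inter_union_compl]

theorem union_inter_eq_left {U X Y : Set At} (hX : X ⊆ U) (hY : Y ⊆ Uᶜ) : (X ∪ Y) ∩ U = X := by
  ext a; have := @hX a; have := @hY a; simp_all; tauto

theorem union_inter_compl_eq_right {U X Y : Set At} (hX : X ⊆ U) (hY : Y ⊆ Uᶜ) :
    (X ∪ Y) ∩ Uᶜ = Y := by
  rw [Set.union_comm]
  exact union_inter_eq_left hY (by simpa using hX)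

theorem SMs_union {U : Set At} {P Q : Set (ORule At)}
    (hP : ∀ r ∈ P, r.atoms ⊆ U) (hQ : ∀ r ∈ Q, r.atoms ⊆ Uᶜ) :
    SMs (P ∪ Q) = squnion (SMs P) (SMs Q) := by
  ext I
  refine (isStable_union_iff hP hQ).trans ⟨fun ⟨hIP, hIQ⟩ => ?_, ?_⟩
  · exact ⟨_, hIP, _, hIQ, (Set.inter_union_compl I U).symm⟩
  · rintro ⟨X, hX, Y, hY, rfl⟩
    rw [union_inter_eq_left (isStable.subset hP hX) (isStable.subset hQ hY),
      union_inter_compl_eq_right (isStable.subset hP hX) (isStable.subset hQ hY)]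
    exact ⟨hX, hY⟩

/-! ### Subjective literals and the projections of a world view -/

theorem OLit.sat_congr {U I J : Set At} (h : I ∩ U = J ∩ U) {l : OLit At} (hl : l.atoms ⊆ U) :
    l.sat I ↔ l.sat J := by
  have agree : ∀ a ∈ U, (a ∈ I ↔ a ∈ J) := by
    intro a ha
    simpa [ha] using Set.ext_iff.mp h a
  cases l with
  | top => rfl
  | bot => rfl
  | pos a => exact agree a (hl rfl)
  | neg a => exact not_congr (agree a (hl rfl))
  | nneg a => exact agree a (hl rfl)

theorem SLit.sat_congr {U : Set At} {W V : Set (Set At)} (h : proj W U = proj V U)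
    {L : SLit At} (hL : L.atoms ⊆ U) : L.sat W ↔ L.sat V := by
  have proj_iff : ∀ {l : OLit At}, l.atoms ⊆ U → ∀ X : Set (Set At),
      (∃ I ∈ proj X U, l.sat I) ↔ ∃ I ∈ X, l.sat I := by
    intro l hl X
    simp only [proj, Set.exists_mem_image]
    exact exists_congr fun I => and_congr_right fun _ =>
      OLit.sat_congr (by simp [Set.inter_assoc]) hl
  have proj_forall : ∀ {l : OLit At}, l.atoms ⊆ U → ∀ X : Set (Set At),
      (∀ I ∈ proj X U, l.sat I) ↔ ∀ I ∈ X, l.sat I := by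
    intro l hl X
    simp only [proj, Set.forall_mem_image]
    exact forall₂_congr fun I _ => OLit.sat_congr (by simp [Set.inter_assoc]) hl
  cases L with
  | k l => exact (proj_forall hL W).symm.trans (h ▸ proj_forall hL V)
  | m l => exact (proj_iff hL W).symm.trans (h ▸ proj_iff hL V)
  | notk l => exact not_congr ((proj_forall hL W).symm.trans (h ▸ proj_forall hL V))
  | notm l => exact not_congr ((proj_iff hL W).symm.trans (h ▸ proj_iff hL V))

theorem SLit.atoms_subset_compl {U : Set At} {L : SLit At} (hL : ¬ L.atoms ⊆ U) :
    L.atoms ⊆ Uᶜ := by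
  rcases L with l | l | l | l <;> cases l <;> simp_all [SLit.atoms, OLit.atoms]

theorem ERule.fullReduct_congr {U : Set At} {W V : Set (Set At)} (h : proj W U = proj V U)
    {r : ERule At} (hr : r.atoms ⊆ U) : r.fullReduct W = r.fullReduct V := by
  simp only [ERule.fullReduct, ORule.mk.injEq, true_and]
  refine List.map_congr_left fun l hl => ?_
  have hlU : l.atoms ⊆ U :=
    (Set.subset_biUnion_of_mem (u := ELit.atoms) hl).trans (Set.subset_union_right.trans hr)
  cases l with
  | obj l => rfl
  | sub L => simp only [ELit.fullReduct, SLit.sat_congr h hlU]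

theorem ERule.fullReduct_sReduct {U : Set At} {W Wb Wt : Set (Set At)}
    (hb : proj W U = proj Wb U) (ht : proj W Uᶜ = proj Wt Uᶜ) (r : ERule At) :
    (r.sReduct Wb U).fullReduct Wt = r.fullReduct W := by
  simp only [ERule.fullReduct, ERule.sReduct, List.map_map, ORule.mk.injEq, true_and]
  refine List.map_congr_left fun l _ => ?_
  cases l with
  | obj l => rfl
  | sub L =>
    by_cases hL : L.atoms ⊆ U
    · simp only [Function.comp_apply, ELit.sReduct, hL, if_true, ELit.fullReduct,
        SLit.sat_congr hb hL]
      split_ifs <;> rfl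
    · simp only [Function.comp_apply, ELit.sReduct, hL, if_false, ELit.fullReduct,
        SLit.sat_congr ht (SLit.atoms_subset_compl hL)]

theorem ERule.atoms_fullReduct_subset (W : Set (Set At)) (r : ERule At) :
    (r.fullReduct W).atoms ⊆ r.bodyObjAtoms ∪ r.headAtoms := by
  rintro a (ha | ha)
  · exact Or.inr ha
  · simp only [ERule.fullReduct, List.mem_map, Set.mem_iUnion] at ha
    obtain ⟨_, ⟨l, hl, rfl⟩, ha⟩ := ha
    cases l with
    | obj l => exact Or.inl (Set.mem_biUnion (t := ELit.objAtoms) hl ha)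
    | sub L => simp only [ELit.fullReduct] at ha; split_ifs at ha <;> exact ha.elim

theorem ERule.bodyObjAtoms_union_headAtoms_subset (r : ERule At) :
    r.bodyObjAtoms ∪ r.headAtoms ⊆ r.atoms := by
  refine Set.union_subset (Set.iUnion₂_subset fun l hl => ?_) Set.subset_union_left
  refine Set.Subset.trans ?_ ((Set.subset_biUnion_of_mem (u := ELit.atoms) hl).trans
    Set.subset_union_right)
  cases l with
  | obj l => exact Set.Subset.rfl
  | sub L => exact Set.empty_subset _

theorem ERule.bodyObjAtoms_union_headAtoms_sReduct_subset (W : Set (Set At)) (U : Set At)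
    (r : ERule At) :
    (r.sReduct W U).bodyObjAtoms ∪ (r.sReduct W U).headAtoms ⊆ r.bodyObjAtoms ∪ r.headAtoms := by
  refine Set.union_subset_union_left _ (Set.iUnion₂_subset fun l' hl' => ?_)
  obtain ⟨l, hl, rfl⟩ := List.mem_map.mp hl'
  refine Set.Subset.trans ?_ (Set.subset_biUnion_of_mem (u := ELit.objAtoms) hl)
  cases l with
  | obj l => exact Set.Subset.rfl
  | sub L => simp only [ELit.sReduct]; split_ifs <;> exact Set.empty_subset _

theorem eFullReduct_congr {U : Set At} {W V : Set (Set At)} (h : proj W U = proj V U)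
    {P : Set (ERule At)} (hP : ∀ r ∈ P, r.atoms ⊆ U) : eFullReduct P W = eFullReduct P V :=
  Set.image_congr fun r hr => ERule.fullReduct_congr h (hP r hr)

theorem eFullReduct_esReduct {U : Set At} {W Wb Wt : Set (Set At)}
    (hb : proj W U = proj Wb U) (ht : proj W Uᶜ = proj Wt Uᶜ) (P : Set (ERule At)) :
    eFullReduct (esReduct P Wb U) Wt = eFullReduct P W := by
  rw [eFullReduct, esReduct, Set.image_image]
  exact Set.image_congr fun r _ => ERule.fullReduct_sReduct hb ht r

theorem proj_squnion_left {U : Set At} {Wb Wt : Set (Set At)} (hne : Wt.Nonempty)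
    (ht : ∀ I ∈ Wt, I ⊆ Uᶜ) : proj (squnion Wb Wt) U = proj Wb U := by
  have key : ∀ X : Set At, ∀ Y ∈ Wt, (X ∪ Y) ∩ U = X ∩ U := by
    intro X Y hY
    rw [Set.union_inter_distrib_right,
      (Set.disjoint_left.mpr fun a ha => ht Y hY ha : Disjoint Y U).inter_eq, Set.union_empty]
  obtain ⟨Y₀, hY₀⟩ := hne
  ext I
  constructor
  · rintro ⟨_, ⟨X, hX, Y, hY, rfl⟩, rfl⟩
    exact ⟨X, hX, (key X Y hY).symm⟩
  · rintro ⟨X, hX, rfl⟩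
    exact ⟨_, ⟨X, hX, Y₀, hY₀, rfl⟩, key X Y₀ hY₀⟩

theorem squnion_comm (V W : Set (Set At)) : squnion V W = squnion W V := by
  ext I
  constructor <;> rintro ⟨X, hX, Y, hY, rfl⟩ <;> exact ⟨Y, hY, X, hX, Set.union_comm _ _⟩

theorem proj_squnion_right {U : Set At} {Wb Wt : Set (Set At)} (hne : Wb.Nonempty)
    (hb : ∀ I ∈ Wb, I ⊆ U) : proj (squnion Wb Wt) Uᶜ = proj Wt Uᶜ := by
  rw [squnion_comm]
  exact proj_squnion_left hne (by simpa using hb)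

/-- Main Theorem: the G91 semantics satisfies epistemic splitting. -/
theorem g91_epistemic_splitting (U : Set At) (P B T : Set (ERule At))
    (h : isEpiSplitting U P B T) (W : Set (Set At)) :
    isG91WorldView W P ↔
      ∃ Wb Wt : Set (Set At),
        isG91WorldView Wb B ∧ isG91WorldView Wt (esReduct T Wb U) ∧
          W = squnion Wb Wt := by
  obtain ⟨-, rfl, hB, hT⟩ := h
  have hBU : ∀ V, ∀ r ∈ eFullReduct B V, r.atoms ⊆ U := by
    rintro V _ ⟨r, hr, rfl⟩
    exact (r.atoms_fullReduct_subset V).trans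
      (r.bodyObjAtoms_union_headAtoms_subset.trans (hB r hr))
  have hTU : ∀ V, ∀ r ∈ eFullReduct T V, r.atoms ⊆ Uᶜ := by
    rintro V _ ⟨r, hr, rfl⟩
    exact (r.atoms_fullReduct_subset V).trans
      (Set.subset_compl_iff_disjoint_right.mpr (Set.disjoint_iff_inter_eq_empty.mpr (hT r hr)))
  have hSM : ∀ V, SMs (eFullReduct (B ∪ T) V) =
      squnion (SMs (eFullReduct B V)) (SMs (eFullReduct T V)) := by
    intro V
    rw [eFullReduct, Set.image_union]
    exact SMs_union (hBU V) (hTU V)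
  constructor
  · rintro ⟨hne, hW⟩
    rw [hSM] at hW
    have hnes : (SMs (eFullReduct B W)).Nonempty ∧ (SMs (eFullReduct T W)).Nonempty := by
      rw [hW] at hne
      obtain ⟨_, X, hX, Y, hY, -⟩ := hne
      exact ⟨⟨X, hX⟩, ⟨Y, hY⟩⟩
    have hb : proj W U = proj (SMs (eFullReduct B W)) U :=
      (congrArg (proj · U) hW).trans
        (proj_squnion_left hnes.2 fun I hI => isStable.subset (hTU W) hI)
    have ht : proj W Uᶜ = proj (SMs (eFullReduct T W)) Uᶜ :=
      (congrArg (proj · Uᶜ) hW).trans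
        (proj_squnion_right hnes.1 fun I hI => isStable.subset (hBU W) hI)
    exact ⟨_, _, ⟨hnes.1, congrArg SMs (eFullReduct_congr hb hB)⟩,
      ⟨hnes.2, congrArg SMs (eFullReduct_esReduct hb ht T).symm⟩, hW⟩
  · rintro ⟨Wb, Wt, ⟨hbne, hWb⟩, ⟨htne, hWt⟩, rfl⟩
    have hbU : ∀ I ∈ Wb, I ⊆ U := by
      intro I hI
      rw [hWb] at hI
      exact isStable.subset (hBU Wb) hI
    have htU : ∀ I ∈ Wt, I ⊆ Uᶜ := by
      intro I hI
      rw [hWt] at hI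
      refine isStable.subset ?_ hI
      rintro _ ⟨_, ⟨r, hr, rfl⟩, rfl⟩
      exact ((r.sReduct Wb U).atoms_fullReduct_subset Wt).trans
        ((r.bodyObjAtoms_union_headAtoms_sReduct_subset Wb U).trans
          (Set.subset_compl_iff_disjoint_right.mpr
            (Set.disjoint_iff_inter_eq_empty.mpr (hT r hr))))
    have hb := proj_squnion_left (Wb := Wb) htne htU
    have ht := proj_squnion_right (Wt := Wt) hbne hbU
    refine ⟨?_, ?_⟩
    · obtain ⟨X, hX⟩ := hbne
      obtain ⟨Y, hY⟩ := htne
      exact ⟨_, X, hX, Y, hY, rfl⟩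
    · rw [hSM, eFullReduct_congr hb hB, ← eFullReduct_esReduct hb ht T, ← hWb, ← hWt]
end
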